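/- Let G be a countable group acting faithfully on the right by homeomorphisms on a second countable Hausdorff topological space X, and let μ be an ergodic invariant random subgroup of G. Suppose that for every nonempty open set V ⊆ X the rigid stabilizer R_G(V) has no fixed point in V, i.e. for every x ∈ V there is g ∈ R_G(V) with x·g ≠ x. Then μ-almost every subgroup H ≤ G has the following property: for every x ∈ X that is not a fixed point of H, there exists an open neighborhood U of x such that [R_G(U), R_G(U)] ≤ H. -/

import Mathlib

open MulOpposite MeasureTheory

/-- The σ-algebra on the space of subgroups of `G`, generated by the sets
`{H : g ∈ H}` for `g ∈ G` (the Borel σ-algebra of the Chabauty topology). -/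
instance subgroupMeasurableSpace (G : Type*) [Group G] : MeasurableSpace (Subgroup G) :=
  MeasurableSpace.generateFrom {A : Set (Subgroup G) | ∃ g : G, A = {H : Subgroup G | g ∈ H}}

/-- Conjugation `H ↦ g⁻¹ H g` on subgroups. -/
def conjSubgroup {G : Type*} [Group G] (g : G) (H : Subgroup G) : Subgroup G :=
  Subgroup.map (MulAut.conj g⁻¹).toMonoidHom H

/-- Pointwise stabilizer of a set `A ⊆ X` for a right action of `G` on `X`:
`{g ∈ G : x·g = x for all x ∈ A}`. -/
def pointwiseStabilizer (G : Type*) {X : Type*} [Group G] [MulAction Gᵐᵒᵖ X] (A : Set X) :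
    Subgroup G where
  carrier := {g : G | ∀ x ∈ A, op g • x = x}
  one_mem' := by intro x _; simp
  mul_mem' := by
    intro g h hg hh x hx
    have h1 : op (g * h) • x = op h • (op g • x) := by
      rw [op_mul, mul_smul]
    rw [h1, hg x hx, hh x hx]
  inv_mem' := by
    intro g hg x hx
    have h1 : op g⁻¹ • (op g • x) = x := by
      rw [op_inv]; exact inv_smul_smul _ _
    rw [hg x hx] at h1
    exact h1

/-- Rigid stabilizer `R_G(U) = {g ∈ G : x·g = x for all x ∈ X \ U}`. -/
def rigidStabilizer (G : Type*) {X : Type*} [Group G] [MulAction Gᵐᵒᵖ X] (U : Set X) :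
    Subgroup G :=
  pointwiseStabilizer G Uᶜ

/-- The fixed-point set of a subgroup `H` in `X`: `Fix(H) = {x : x·h = x for all h ∈ H}`. -/
def fixedSet (X : Type*) {G : Type*} [Group G] [MulAction Gᵐᵒᵖ X] (H : Subgroup G) : Set X :=
  {x : X | ∀ h ∈ H, op h • x = x}

lemma mem_conjSubgroup_iff {G : Type*} [Group G] (g h : G) (H : Subgroup G) :
    h ∈ conjSubgroup g H ↔ g * h * g⁻¹ ∈ H := by
  unfold conjSubgroup
  rw [Subgroup.mem_map]
  constructor
  · rintro ⟨y, hy, rfl⟩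
    simpa [MulAut.conj_apply, mul_assoc] using hy
  · intro hh
    exact ⟨_, hh, by simp [MulAut.conj_apply, mul_assoc]⟩

lemma measurableSet_mem_subgroup {G : Type*} [Group G] (g : G) :
    MeasurableSet {H : Subgroup G | g ∈ H} :=
  MeasurableSpace.measurableSet_generateFrom ⟨g, rfl⟩

lemma measurable_conjSubgroup {G : Type*} [Group G] (g : G) :
    Measurable (fun H : Subgroup G => conjSubgroup g H) := by
  apply measurable_generateFrom
  rintro _ ⟨h, rfl⟩
  have : (fun H : Subgroup G => conjSubgroup g H) ⁻¹' {H | h ∈ H}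
      = {H | g * h * g⁻¹ ∈ H} := by
    ext H
    exact mem_conjSubgroup_iff g h H
  rw [this]
  exact measurableSet_mem_subgroup _

/-- The recurrence lemma. -/
lemma irs_recurrence {G : Type*} [Group G] [Countable G]
    (μ : Measure (Subgroup G)) [IsProbabilityMeasure μ]
    (hinv : ∀ g : G, ∀ A : Set (Subgroup G), MeasurableSet A →
      μ ((fun H : Subgroup G => conjSubgroup g H) ⁻¹' A) = μ A)
    (A : Subgroup G) (h : G) :
    ∀ᵐ H ∂μ, h ∈ H → ∃ k : ℕ, ∀ γ : Fin k → A, ∃ i j, i ≠ j ∧ ∃ c : A,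
      ((γ i : G) * c)⁻¹ * h * (γ i * c) ∈ H ∧ ((γ j : G) * c)⁻¹ * h * (γ j * c) ∈ H := by
  classical
  set O : (k : ℕ) → (Fin k → A) → Set (Subgroup G) := fun k γ =>
    {H | ∀ i j, i ≠ j → ∀ c : A, ¬ (((γ i : G) * c)⁻¹ * h * (γ i * c) ∈ H ∧
      ((γ j : G) * c)⁻¹ * h * (γ j * c) ∈ H)} with hO
  have hOm : ∀ k γ, MeasurableSet (O k γ) := by
    intro k γ
    simp only [hO, Set.ofPred_forall]
    refine MeasurableSet.iInter fun i => MeasurableSet.iInter fun j =>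
      MeasurableSet.iInter fun _ => MeasurableSet.iInter fun c => ?_
    exact ((measurableSet_mem_subgroup _).inter (measurableSet_mem_subgroup _)).compl
  have hOinv : ∀ k γ (a : A) (H : Subgroup G), conjSubgroup (a : G) H ∈ O k γ ↔ H ∈ O k γ := by
    intro k γ a H
    simp only [hO, Set.mem_ofPred_eq, mem_conjSubgroup_iff]
    constructor
    · intro hh i j hij c hc
      apply hh i j hij (c * a)
      simpa [mul_assoc] using hc
    · intro hh i j hij c hc
      apply hh i j hij (c * a⁻¹)
      simpa [mul_assoc] using hc
  have hEm : MeasurableSet {H : Subgroup G | h ∈ H} := measurableSet_mem_subgroup h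
  have hbound : ∀ k : ℕ, μ ({H : Subgroup G | h ∈ H} ∩ ⋃ γ, O k γ) * k ≤ 1 := by
    intro k
    obtain ⟨e, he⟩ := exists_surjective_nat (Fin k → A)
    set D : ℕ → Set (Subgroup G) := fun n => {H | H ∈ O k (e n) ∧ ∀ m < n, H ∉ O k (e m)} with hD
    have hDm : ∀ n, MeasurableSet (D n) := by
      intro n
      have : D n = O k (e n) ∩ ⋂ m, ⋂ (_ : m < n), (O k (e m))ᶜ := by
        ext H; simp [hD]
      rw [this]
      exact (hOm _ _).inter (MeasurableSet.iInter fun m => MeasurableSet.iInter fun _ =>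
        (hOm _ _).compl)
    have hDinv : ∀ n (a : A) (H : Subgroup G), conjSubgroup (a : G) H ∈ D n ↔ H ∈ D n := by
      intro n a H
      simp only [hD, Set.mem_ofPred_eq, hOinv]
    have hDdisj : Pairwise (Function.onFun Disjoint D) := by
      intro m n hmn
      rw [Function.onFun, Set.disjoint_left]
      intro H h1 h2
      rcases lt_or_gt_of_ne hmn with hl | hl
      · exact h2.2 m hl h1.1
      · exact h1.2 n hl h2.1
    have hcover : (⋃ γ, O k γ) ⊆ ⋃ n, D n := by
      intro H hH
      obtain ⟨γ, hγ⟩ := Set.mem_iUnion.1 hH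
      obtain ⟨n, rfl⟩ := he γ
      have hex : ∃ n, H ∈ O k (e n) := ⟨n, hγ⟩
      exact Set.mem_iUnion.2 ⟨Nat.find hex, Nat.find_spec hex, fun m hm => Nat.find_min hex hm⟩
    have hstep : ∀ n, μ ({H : Subgroup G | h ∈ H} ∩ D n) * k ≤ μ (D n) := by
      intro n
      set F : Fin k → Set (Subgroup G) := fun i =>
        (fun H : Subgroup G => conjSubgroup ((e n i : G)⁻¹) H) ⁻¹' ({H | h ∈ H} ∩ D n) with hF
      have hFm : ∀ i, MeasurableSet (F i) := fun i =>
        measurable_conjSubgroup _ (hEm.inter (hDm n))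
      have hFmem : ∀ i H, H ∈ F i ↔ (e n i : G)⁻¹ * h * (e n i) ∈ H ∧ H ∈ D n := by
        intro i H
        have := hDinv n (e n i)⁻¹ H
        simp only [hF, Set.mem_preimage, Set.mem_inter_iff, Set.mem_ofPred_eq,
          mem_conjSubgroup_iff, inv_inv]
        rw [← this]
        simp
      have hFdisj : Pairwise (Function.onFun Disjoint F) := by
        intro i j hij
        rw [Function.onFun, Set.disjoint_left]
        intro H h1 h2
        rw [hFmem] at h1 h2
        exact h1.2.1 i j hij 1 (by simpa using ⟨h1.1, h2.1⟩)
      have h1 : μ (⋃ i, F i) = ∑' i, μ (F i) := measure_iUnion hFdisj hFm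
      have h2 : ∀ i, μ (F i) = μ ({H : Subgroup G | h ∈ H} ∩ D n) := fun i =>
        hinv _ _ (hEm.inter (hDm n))
      have h3 : (⋃ i, F i) ⊆ D n := Set.iUnion_subset fun i H hH => ((hFmem i H).1 hH).2
      have h4 := measure_mono (μ := μ) h3
      rw [h1, tsum_fintype] at h4
      simp only [h2, Finset.sum_const, Finset.card_univ, Fintype.card_fin, nsmul_eq_mul] at h4
      rwa [mul_comm]
    calc μ ({H : Subgroup G | h ∈ H} ∩ ⋃ γ, O k γ) * k
        ≤ μ (⋃ n, ({H : Subgroup G | h ∈ H} ∩ D n)) * k := by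
          gcongr
          rw [← Set.inter_iUnion]
          exact Set.inter_subset_inter_right _ hcover
      _ ≤ (∑' n, μ ({H : Subgroup G | h ∈ H} ∩ D n)) * k := by
          gcongr
          exact measure_iUnion_le _
      _ = ∑' n, μ ({H : Subgroup G | h ∈ H} ∩ D n) * k := ENNReal.tsum_mul_right.symm
      _ ≤ ∑' n, μ (D n) := ENNReal.tsum_le_tsum hstep
      _ = μ (⋃ n, D n) := (measure_iUnion hDdisj hDm).symm
      _ ≤ 1 := prob_le_one
  rw [ae_iff]
  set N := {H : Subgroup G | ¬ (h ∈ H → ∃ k : ℕ, ∀ γ : Fin k → A, ∃ i j, i ≠ j ∧ ∃ c : A,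
      ((γ i : G) * c)⁻¹ * h * (γ i * c) ∈ H ∧ ((γ j : G) * c)⁻¹ * h * (γ j * c) ∈ H)} with hN
  have hsub : ∀ k, N ⊆ {H : Subgroup G | h ∈ H} ∩ ⋃ γ, O k γ := by
    intro k H hH
    simp only [hN, Set.mem_ofPred_eq, Classical.not_imp, not_exists] at hH
    refine ⟨hH.1, ?_⟩
    have := hH.2 k
    push Not at this
    obtain ⟨γ, hγ⟩ := this
    refine Set.mem_iUnion.2 ⟨γ, fun i j hij c hc => hγ i j hij c hc.1 hc.2⟩
  have hle : ∀ k : ℕ, μ N * k ≤ 1 := fun k =>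
    le_trans (by gcongr; exact hsub k) (hbound k)
  by_contra hne
  have hfin : μ N ≠ ⊤ := measure_ne_top _ _
  obtain ⟨k, hk⟩ := ENNReal.exists_nat_gt (r := (μ N)⁻¹) (by simpa using hne)
  have h1 : μ N * (μ N)⁻¹ < μ N * k := (ENNReal.mul_lt_mul_iff_right hne hfin).2 hk
  rw [ENNReal.mul_inv_cancel hne hfin] at h1
  exact absurd (hle k) (not_le.2 h1)

section Det

variable {G X : Type*} [Group G] [MulAction Gᵐᵒᵖ X]

lemma op_mul_act (g h : G) (x : X) : op (g * h) • x = op h • (op g • x) := by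
  rw [op_mul, mul_smul]

lemma op_inv_act (g : G) (x y : X) : op g⁻¹ • x = y ↔ x = op g • y := by
  rw [op_inv, inv_smul_eq_iff]

lemma act_ne {g : G} {x y : X} (h : x ≠ y) : op g • x ≠ op g • y := by
  simpa using h

lemma mem_rigid {U : Set X} {g : G} :
    g ∈ rigidStabilizer G U ↔ ∀ x, x ∉ U → op g • x = x := Iff.rfl

lemma mem_pstab {U : Set X} {g : G} :
    g ∈ pointwiseStabilizer G U ↔ ∀ x, x ∈ U → op g • x = x := Iff.rfl

lemma rigid_mono {U V : Set X} (h : U ⊆ V) :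
    rigidStabilizer G U ≤ rigidStabilizer G V :=
  fun _ hg x hx => hg x (fun hxU => hx (h hxU))

lemma rigid_act_mem {U : Set X} {g : G} (hg : g ∈ rigidStabilizer G U) {x : X} (hx : x ∈ U) :
    op g • x ∈ U := by
  by_contra h
  have h1 := hg _ h
  exact h ((smul_left_cancel _ h1).symm ▸ hx)

lemma pstab_act_not_mem {U : Set X} {g : G} (hg : g ∈ pointwiseStabilizer G U) {x : X}
    (hx : x ∉ U) : op g • x ∉ U := by
  intro h
  have h1 := hg _ h
  exact hx ((smul_left_cancel _ h1) ▸ h)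

lemma commute_of_rigid_pstab (hfaith : ∀ g : G, (∀ x : X, op g • x = x) → g = 1)
    {U : Set X} {a b : G} (ha : a ∈ rigidStabilizer G U) (hb : b ∈ pointwiseStabilizer G U) :
    a * b = b * a := by
  rw [← mul_inv_eq_one]
  apply hfaith
  intro x
  rw [op_mul_act, op_inv_act, op_mul_act, op_mul_act]
  by_cases hx : x ∈ U
  · rw [hb x hx, hb _ (rigid_act_mem ha hx)]
  · rw [ha x hx, ha _ (pstab_act_not_mem hb hx)]

/-- The double commutator identity. -/
lemma double_comm (hfaith : ∀ g : G, (∀ x : X, op g • x = x) → g = 1)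
    {W : Set X} {k m₁ m₂ : G} (hk : ∀ y ∈ W, op k • y ∉ W)
    (h₁ : m₁ ∈ rigidStabilizer G W) (h₂ : m₂ ∈ rigidStabilizer G W) :
    m₁ * (m₂ * k * m₂⁻¹ * k⁻¹) * m₁⁻¹ * (m₂ * k * m₂⁻¹ * k⁻¹)⁻¹ = (m₁ * m₂ * m₁⁻¹ * m₂⁻¹) := by
  have hq : k * m₂⁻¹ * k⁻¹ ∈ pointwiseStabilizer G W := by
    intro y hy
    rw [op_mul_act, op_mul_act, op_inv_act]
    exact (inv_mem h₂) _ (hk y hy)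
  have hc := commute_of_rigid_pstab hfaith (inv_mem h₁) hq
  have e : m₂ * k * m₂⁻¹ * k⁻¹ = m₂ * (k * m₂⁻¹ * k⁻¹) := by group
  rw [e]
  generalize k * m₂⁻¹ * k⁻¹ = q at hc
  calc m₁ * (m₂ * q) * m₁⁻¹ * (m₂ * q)⁻¹ = m₁ * m₂ * (q * m₁⁻¹) * q⁻¹ * m₂⁻¹ := by group
    _ = _ := by rw [← hc]; group

variable [TopologicalSpace X] [T2Space X]

lemma exists_displaced (hcont : ∀ g : G, Continuous fun x : X => op g • x)
    {U : Set X} (hU : IsOpen U) {x : X} (hx : x ∈ U) {k : G} (hk : op k • x ≠ x) :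
    ∃ W : Set X, IsOpen W ∧ x ∈ W ∧ W ⊆ U ∧ ∀ y ∈ W, op k • y ∉ W := by
  obtain ⟨P, Q, hP, hQ, hxP, hxQ, hPQ⟩ := t2_separation hk
  refine ⟨U ∩ Q ∩ (fun y : X => op k • y) ⁻¹' P, (hU.inter hQ).inter (hP.preimage (hcont k)),
    ⟨⟨hx, hxQ⟩, hxP⟩, fun y hy => hy.1.1, ?_⟩
  intro y hy hy'
  exact Set.disjoint_left.1 hPQ hy.2 hy'.1.2

/-- Orbits of rigid stabilizers are infinite. -/
lemma exists_orbit_seq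
    (hnofix : ∀ V : Set X, IsOpen V → ∀ x ∈ V, ∃ g ∈ rigidStabilizer G V, op g • x ≠ x)
    {W : Set X} (hW : IsOpen W) {y : X} (hy : y ∈ W) :
    ∃ γ : ℕ → G, (∀ i, γ i ∈ rigidStabilizer G W) ∧
      ∀ i j, i ≠ j → op (γ i) • y ≠ op (γ j) • y := by
  set Z : Set X := {z | ∃ g ∈ rigidStabilizer G W, op g • y = z} with hZ
  have hinf : Z.Infinite := by
    intro hfin
    have hopen : IsOpen (W \ (Z \ {y})) := hW.sdiff (hfin.subset Set.sdiff_subset).isClosed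
    obtain ⟨g, hg, hgy⟩ := hnofix _ hopen y ⟨hy, fun h => h.2 rfl⟩
    have hg' := rigid_mono (G := G) (Set.sdiff_subset : W \ (Z \ {y}) ⊆ W) hg
    have h1 : op g • y ∈ Z \ {y} := ⟨⟨g, hg', rfl⟩, hgy⟩
    have h2 : op g • (op g • y) = op g • y := hg _ (fun h => h.2 h1)
    exact hgy (smul_left_cancel _ h2)
  have hmem : ∀ i, ∃ g ∈ rigidStabilizer G W, op g • y = (hinf.natEmbedding Z i : X) :=
    fun i => (hinf.natEmbedding Z i).2
  choose γ h1 h2 using hmem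
  refine ⟨γ, h1, fun i j hij h => hij ?_⟩
  rw [h2, h2] at h
  exact (hinf.natEmbedding Z).injective (Subtype.ext h)

/-- The subgroup of `s ∈ R_G(U)` having a partner fixing `U` pointwise. -/
def partnerSubgroup (hfaith : ∀ g : G, (∀ x : X, op g • x = x) → g = 1)
    (U : Set X) (H : Subgroup G) : Subgroup G where
  carrier := {s | s ∈ rigidStabilizer G U ∧ ∃ b ∈ pointwiseStabilizer G U, s * b ∈ H}
  one_mem' := ⟨one_mem _, 1, one_mem _, by simp⟩
  mul_mem' := by
    rintro s t ⟨hs, b, hb, hsb⟩ ⟨ht, c, hc, htc⟩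
    refine ⟨mul_mem hs ht, b * c, mul_mem hb hc, ?_⟩
    have := mul_mem hsb htc
    have e : s * t * (b * c) = s * b * (t * c) := by
      rw [mul_assoc, ← mul_assoc t, commute_of_rigid_pstab hfaith ht hb]; group
    rwa [e]
  inv_mem' := by
    rintro s ⟨hs, b, hb, hsb⟩
    refine ⟨inv_mem hs, b⁻¹, inv_mem hb, ?_⟩
    have := inv_mem hsb
    rwa [commute_of_rigid_pstab hfaith hs hb, mul_inv_rev] at this

theorem det_part
    (hcont : ∀ g : G, Continuous fun x : X => op g • x)
    (hfaith : ∀ g : G, (∀ x : X, op g • x = x) → g = 1)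
    (hnofix : ∀ V : Set X, IsOpen V → ∀ x ∈ V, ∃ g ∈ rigidStabilizer G V, op g • x ≠ x)
    (H : Subgroup G) (B : Set (Set X)) (hB : TopologicalSpace.IsTopologicalBasis B)
    (hrec : ∀ U ∈ B, ∀ h ∈ H, ∃ k : ℕ, ∀ γ : Fin k → rigidStabilizer G U,
      ∃ i j, i ≠ j ∧ ∃ c : rigidStabilizer G U,
      ((γ i : G) * c)⁻¹ * h * (γ i * c) ∈ H ∧ ((γ j : G) * c)⁻¹ * h * (γ j * c) ∈ H)
    (x : X) (hx : x ∉ fixedSet X H) :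
    ∃ U : Set X, IsOpen U ∧ x ∈ U ∧ ⁅rigidStabilizer G U, rigidStabilizer G U⁆ ≤ H := by
  classical
  obtain ⟨g, hgH, hgx⟩ : ∃ g ∈ H, op g • x ≠ x := by
    simpa [fixedSet] using hx
  obtain ⟨U₀, hU₀o, hxU₀, -, hU₀g⟩ := exists_displaced hcont isOpen_univ (Set.mem_univ x) hgx
  obtain ⟨U, hUB, hxU, hUU₀⟩ := hB.exists_subset_of_mem_open hxU₀ hU₀o
  have hUo : IsOpen U := hB.isOpen hUB
  have hUg : ∀ y ∈ U, op g • y ∉ U := fun y hy h => hU₀g y (hUU₀ hy) (hUU₀ h)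
  set A := rigidStabilizer G U with hA
  set S := partnerSubgroup hfaith U H with hS
  have hSA : S ≤ A := fun s hs => hs.1
  -- S contains inverses of return times
  have hTS : ∀ t ∈ A, t⁻¹ * g * t ∈ H → t ∈ S := by
    intro t ht hgt
    rw [← inv_mem_iff]
    refine ⟨inv_mem ht, g * t * g⁻¹, ?_, ?_⟩
    · intro y hy
      rw [op_mul_act, op_mul_act, op_inv_act]
      exact ht _ (hUg y hy)
    · have := mul_mem hgt (inv_mem hgH)
      simpa [mul_assoc] using this
  -- S has finite index in A
  have hfin : (S.subgroupOf A).FiniteIndex := by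
    by_contra hnot
    have hinf : Infinite (A ⧸ S.subgroupOf A) := by
      by_contra hni
      rw [not_infinite_iff_finite] at hni
      exact hnot Subgroup.finiteIndex_of_finite_quotient
    obtain ⟨k, hk⟩ := hrec U hUB g hgH
    let em : ℕ ↪ (A ⧸ S.subgroupOf A) := Infinite.natEmbedding _
    obtain ⟨i, j, hij, c, h1, h2⟩ := hk fun i => ((em i).out)⁻¹
    have s1 := hTS _ (mul_mem ((em i).out⁻¹).2 c.2) h1
    have s2 := hTS _ (mul_mem ((em j).out⁻¹).2 c.2) h2
    have s3 := mul_mem s1 (inv_mem s2)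
    apply hij
    apply Fin.ext
    apply em.injective
    rw [← QuotientGroup.out_eq' (em i), ← QuotientGroup.out_eq' (em j), QuotientGroup.eq,
      Subgroup.mem_subgroupOf]
    simpa [mul_assoc] using s3
  -- normal finite index subgroup
  set D' : Subgroup A := (S.subgroupOf A).normalCore with hD'
  have hD'fin : D'.FiniteIndex := inferInstance
  set D : Subgroup G := D'.map A.subtype with hD
  have hDA : D ≤ A := by
    rintro _ ⟨d, -, rfl⟩; exact d.2
  have hDS : D ≤ S := by
    rintro _ ⟨d, hd, rfl⟩
    exact Subgroup.mem_subgroupOf.1 (Subgroup.normalCore_le _ hd)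
  have hDconj : ∀ a ∈ A, ∀ d ∈ D, a * d * a⁻¹ ∈ D := by
    rintro a ha _ ⟨d, hd, rfl⟩
    exact ⟨⟨a, ha⟩ * d * ⟨a, ha⟩⁻¹,
      (Subgroup.normalCore_normal (S.subgroupOf A)).conj_mem d hd ⟨a, ha⟩, rfl⟩
  obtain ⟨F, hFfin, hFA, hF⟩ : ∃ F : Set G, F.Finite ∧ F ⊆ A ∧ ∀ a ∈ A, ∃ f ∈ F, a * f⁻¹ ∈ D := by
    refine ⟨Set.range fun q : A ⧸ D' => ((q.out : A)⁻¹ : G), Set.finite_range _, ?_, ?_⟩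
    · rintro _ ⟨q, rfl⟩
      exact inv_mem q.out.2
    · intro a ha
      refine ⟨_, ⟨QuotientGroup.mk (⟨a, ha⟩⁻¹ : A), rfl⟩, ?_⟩
      have h1 : (QuotientGroup.mk (⟨a, ha⟩⁻¹ : A) : A ⧸ D') =
        QuotientGroup.mk (QuotientGroup.mk (⟨a, ha⟩⁻¹ : A) : A ⧸ D').out :=
        (QuotientGroup.out_eq' _).symm
      rw [QuotientGroup.eq] at h1
      exact ⟨_, h1, by simp⟩
  -- D moves points locally
  have hDmove : ∀ W : Set X, IsOpen W → W ⊆ U → ∀ y ∈ W,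
      ∃ d ∈ D, d ∈ rigidStabilizer G W ∧ op d • y ≠ y := by
    intro W hWo hWU y hy
    obtain ⟨γ, hγ, hγd⟩ := exists_orbit_seq hnofix hWo hy
    have hγA : ∀ i, γ i ∈ A := fun i => rigid_mono hWU (hγ i)
    obtain ⟨i, j, hij, he⟩ := Finite.exists_ne_map_eq_of_infinite
      (fun i : ℕ => (QuotientGroup.mk (⟨γ i, hγA i⟩⁻¹ : A) : A ⧸ D'))
    rw [QuotientGroup.eq] at he
    refine ⟨γ i * (γ j)⁻¹, ⟨_, he, by simp⟩, mul_mem (hγ i) (inv_mem (hγ j)), ?_⟩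
    rw [op_mul_act, Ne, op_inv_act]
    exact hγd i j hij
  -- S normalizes K = H ∩ A
  have hSnorm : ∀ s ∈ S, ∀ k ∈ H ⊓ A, s * k * s⁻¹ ∈ H ⊓ A := by
    rintro s ⟨hs, b, hb, hsb⟩ k hkK
    have hkH : k ∈ H := (Subgroup.mem_inf.1 hkK).1
    have hkA : k ∈ A := (Subgroup.mem_inf.1 hkK).2
    rw [Subgroup.mem_inf]
    refine ⟨?_, mul_mem (mul_mem hs hkA) (inv_mem hs)⟩
    have h1 := mul_mem (mul_mem hsb hkH) (inv_mem hsb)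
    have h2 := commute_of_rigid_pstab hfaith hkA hb
    have e : s * b * k * (s * b)⁻¹ = s * k * s⁻¹ := by
      rw [mul_assoc s b k, ← h2]; group
    rwa [e] at h1
  -- K moves every point of U
  have hKmove : ∀ y ∈ U, ∃ k ∈ H ⊓ A, op k • y ≠ y := by
    intro y hy
    obtain ⟨a, haD, -, hay⟩ := hDmove U hUo le_rfl y hy
    obtain ⟨haA, b, hb, hab⟩ := hDS haD
    obtain ⟨V, hVB, hayV, hVU⟩ := hB.exists_subset_of_mem_open
      (a := op a • y) (u := U \ {y}) ⟨rigid_act_mem haA hy, hay⟩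
      (hUo.sdiff isClosed_singleton)
    have hyV : y ∉ V := fun h => (hVU h).2 rfl
    have hVA : rigidStabilizer G V ≤ A := rigid_mono (fun z hz => (hVU hz).1)
    obtain ⟨γ, hγ, hγd⟩ := exists_orbit_seq hnofix (hB.isOpen hVB) hayV
    obtain ⟨k, hk⟩ := hrec V hVB (a * b) hab
    obtain ⟨i, j, hij, c, h1, h2⟩ := hk fun i => ⟨γ i, hγ i⟩
    have hij' : (i : ℕ) ≠ j := fun h => hij (Fin.ext h)
    have hd := hγd i j hij'
    have hsV : γ i * c ∈ rigidStabilizer G V := mul_mem (hγ i) c.2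
    have htV : γ j * c ∈ rigidStabilizer G V := mul_mem (hγ j) c.2
    have hst : op (γ i * (c : G)) • (op a • y) ≠ op (γ j * (c : G)) • (op a • y) := by
      rw [op_mul_act, op_mul_act]
      exact act_ne hd
    simp only at h1 h2
    generalize γ i * (c : G) = s at *
    generalize γ j * (c : G) = t at *
    have hs := commute_of_rigid_pstab hfaith (hVA hsV) hb
    have ht := commute_of_rigid_pstab hfaith (hVA htV) hb
    have e1 : s⁻¹ * (a * b) * s = s⁻¹ * a * s * b := by
      rw [mul_assoc, mul_assoc a, ← hs]; group
    have e2 : t⁻¹ * (a * b) * t = t⁻¹ * a * t * b := by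
      rw [mul_assoc, mul_assoc a, ← ht]; group
    have h3 := mul_mem h1 (inv_mem h2)
    rw [e1, e2] at h3
    have e3 : s⁻¹ * a * s * b * (t⁻¹ * a * t * b)⁻¹ = s⁻¹ * a * s * (t⁻¹ * a⁻¹ * t) := by group
    rw [e3] at h3
    refine ⟨_, Subgroup.mem_inf.2 ⟨h3, ?_⟩, ?_⟩
    · exact mul_mem (mul_mem (mul_mem (inv_mem (hVA hsV)) haA) (hVA hsV))
        (mul_mem (mul_mem (inv_mem (hVA htV)) (inv_mem haA)) (hVA htV))
    · have hys : op s⁻¹ • y = y := inv_mem hsV y hyV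
      have hyt : op t • y = y := htV y hyV
      rw [op_mul_act (s⁻¹ * a * s), op_mul_act (s⁻¹ * a), op_mul_act s⁻¹, hys, op_mul_act, op_mul_act]
      intro h
      rw [← hyt] at h
      have h := smul_left_cancel _ h
      rw [op_inv_act, op_inv_act, hyt] at h
      exact hst h
  -- local sets for the representatives
  have hWf : ∀ f ∈ F, ∃ W : Set X, IsOpen W ∧ x ∈ W ∧ W ⊆ U ∧
      ∀ m₁ ∈ D, ∀ m₂ ∈ D, m₁ ∈ rigidStabilizer G W → m₂ ∈ rigidStabilizer G W →
        f * (m₁ * m₂ * m₁⁻¹ * m₂⁻¹) * f⁻¹ ∈ H ⊓ A := by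
    intro f hf
    have hfA : f ∈ A := hFA hf
    obtain ⟨k, hk, hky⟩ := hKmove (op f⁻¹ • x) (rigid_act_mem (inv_mem hfA) hxU)
    have hk' : op (f⁻¹ * k * f) • x ≠ x := by
      rw [op_mul_act, op_mul_act]
      intro h
      apply hky
      rw [eq_comm, op_inv_act]
      exact h.symm
    obtain ⟨W, hWo, hxW, hWU, hW⟩ := exists_displaced hcont hUo hxU hk'
    refine ⟨W, hWo, hxW, hWU, fun m₁ h₁ m₂ h₂ hm₁ hm₂ => ?_⟩
    rw [← double_comm hfaith hW hm₁ hm₂]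
    have n1 := hDS (hDconj f hfA _ h₁)
    have n2 := hDS (hDconj f hfA _ h₂)
    have p := mul_mem (hSnorm _ n2 k hk) (inv_mem hk)
    have q := mul_mem (hSnorm _ n1 _ p) (inv_mem p)
    convert q using 1
    group
  choose! Wf hWo hxW hWU hWc using hWf
  set W : Set X := U ∩ ⋂ f ∈ F, Wf f with hWdef
  have hWopen : IsOpen W := hUo.inter (hFfin.isOpen_biInter hWo)
  have hxWW : x ∈ W := ⟨hxU, Set.mem_iInter₂.2 hxW⟩
  -- the normal part of K moves x
  obtain ⟨k, hkA, hkH, hkx⟩ : ∃ k ∈ A, (∀ a ∈ A, a * k * a⁻¹ ∈ H) ∧ op k • x ≠ x := by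
    obtain ⟨m₁, hm₁D, hm₁W, hm₁x⟩ := hDmove W hWopen Set.inter_subset_left x hxWW
    obtain ⟨V, hVo, hxV, hVW, hV⟩ := exists_displaced hcont hWopen hxWW hm₁x
    obtain ⟨m₂, hm₂D, hm₂V, hm₂x⟩ := hDmove V hVo (hVW.trans Set.inter_subset_left) x hxV
    have hm₂W := rigid_mono (G := G) hVW hm₂V
    refine ⟨(m₁ * m₂ * m₁⁻¹ * m₂⁻¹), ?_, ?_, ?_⟩
    · exact mul_mem (mul_mem (mul_mem (hDA hm₁D) (hDA hm₂D)) (inv_mem (hDA hm₁D)))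
        (inv_mem (hDA hm₂D))
    · intro a ha
      obtain ⟨f, hf, haf⟩ := hF a ha
      have hsub : W ⊆ Wf f := fun z hz => Set.mem_iInter₂.1 hz.2 f hf
      have h1 := hWc f hf m₁ hm₁D m₂ hm₂D (rigid_mono hsub hm₁W) (rigid_mono hsub hm₂W)
      have h2 := (Subgroup.mem_inf.1 (hSnorm _ (hDS haf) _ h1)).1
      convert h2 using 1
      group
    · rw [op_mul_act, op_mul_act, op_mul_act, hm₂V _ (hV x hxV)]
      rw [Ne, op_inv_act, op_inv_act]
      exact fun h => hm₂x (smul_left_cancel _ h).symm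
  obtain ⟨V, hVo, hxV, hVU, hV⟩ := exists_displaced hcont hUo hxU hkx
  refine ⟨V, hVo, hxV, ?_⟩
  rw [Subgroup.commutator_le]
  intro m₁ h₁ m₂ h₂
  change m₁ * m₂ * m₁⁻¹ * m₂⁻¹ ∈ H
  rw [← double_comm hfaith hV h₁ h₂]
  have hm₁ : m₁ ∈ A := rigid_mono hVU h₁
  have hm₂ : m₂ ∈ A := rigid_mono hVU h₂
  have t1 := hkH _ (mul_mem hm₁ hm₂)
  have t2 := hkH _ hm₁
  have t3 := hkH _ hm₂
  have t4 := hkH _ (one_mem _)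
  have := mul_mem (mul_mem t1 (inv_mem t2)) (mul_mem t4 (inv_mem t3))
  convert this using 1
  group

end Det

/-- **Double commutator lemma for IRSs, part (ii)** (Theorem 1.2(ii)).
Let `G` be a countable group acting faithfully on the right by homeomorphisms on a
second countable Hausdorff space `X` (encoded as a left action of `Gᵐᵒᵖ`, so
`x·g = op g • x`), and let `μ` be an ergodic invariant random subgroup of `G`.
Assume that for every open `V ⊆ X` the rigid stabilizer `R_G(V)` has no fixed point
in `V`.  Then for `μ`-a.e. subgroup `H`: if `x ∈ X` is not a fixed point of `H`, then
there is an open neighborhood `U` of `x` with `[R_G(U), R_G(U)] ≤ H`. -/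
theorem irs_double_commutator_part_ii
    {G X : Type*} [Group G] [Countable G] [TopologicalSpace X]
    [SecondCountableTopology X] [T2Space X] [MulAction Gᵐᵒᵖ X]
    (hcont : ∀ g : G, Continuous fun x : X => op g • x)
    (hfaith : ∀ g : G, (∀ x : X, op g • x = x) → g = 1)
    (hnofix : ∀ V : Set X, IsOpen V → ∀ x ∈ V, ∃ g ∈ rigidStabilizer G V, op g • x ≠ x)
    (μ : Measure (Subgroup G)) [IsProbabilityMeasure μ]
    (hinv : ∀ g : G, ∀ A : Set (Subgroup G), MeasurableSet A →
      μ ((fun H : Subgroup G => conjSubgroup g H) ⁻¹' A) = μ A)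
    (herg : ∀ A : Set (Subgroup G), MeasurableSet A →
      (∀ g : G, (fun H : Subgroup G => conjSubgroup g H) ⁻¹' A = A) → μ A = 0 ∨ μ A = 1) :
    ∀ᵐ H ∂μ, ∀ x : X, x ∉ fixedSet X H →
      ∃ U : Set X, IsOpen U ∧ x ∈ U ∧
        ⁅rigidStabilizer G U, rigidStabilizer G U⁆ ≤ H := by

  have hB := TopologicalSpace.isBasis_countableBasis X
  have hrec : ∀ᵐ H ∂μ, ∀ U ∈ TopologicalSpace.countableBasis X, ∀ h : G, h ∈ H →
      ∃ k : ℕ, ∀ γ : Fin k → rigidStabilizer G U,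
      ∃ i j, i ≠ j ∧ ∃ c : rigidStabilizer G U,
      ((γ i : G) * c)⁻¹ * h * (γ i * c) ∈ H ∧ ((γ j : G) * c)⁻¹ * h * (γ j * c) ∈ H := by
    rw [ae_ball_iff (TopologicalSpace.countable_countableBasis X)]
    intro U _
    rw [ae_all_iff]
    exact fun h => irs_recurrence μ hinv _ h
  filter_upwards [hrec] with H hH x hx
  exact det_part hcont hfaith hnofix H _ hB hH x hx
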